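/- In the policy improvement step, the new decision rule δ improves the value: for all x ≥ 0, x ≤ J_α(x) ≤ J_δ(x) ≤ x + b̄, where J_δ(x) := lim_{n→∞} L_δⁿ 0(x). -/

import Mathlib

open MeasureTheory Set Filter Topology

noncomputable section

/-- The constant `b̄ = β ∫ z⁺ ν(dz) / (1-β)`. -/
def bbar (ν : Measure ℝ) (β : ℝ) : ℝ := β * (∫ z, max z 0 ∂ν) / (1 - β)

/-- The dynamic programming operator `T`. -/
def Tdiv (ν : Measure ℝ) (β γ : ℝ) (v : ℝ → ℝ) (x : ℝ) : ℝ :=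
  if 0 ≤ x then
    sSup ((fun a => a - (β / γ) * Real.log
      ((∫ z in Ici (a - x), Real.exp (-(γ * v (x - a + z))) ∂ν)
        + (ν (Iio (a - x))).toReal)) '' Icc 0 x)
  else 0

/-- Membership in the set `S₀`. -/
def memS0 (ν : Measure ℝ) (β : ℝ) (v : ℝ → ℝ) : Prop :=
  (∀ x, 0 ≤ v x) ∧ (∀ x, 0 ≤ x → v x ≤ x + bbar ν β) ∧ (∀ x, x < 0 → v x = 0)
    ∧ MonotoneOn v (Ici 0) ∧ ContinuousOn v (Ici 0)

/-- Membership in the set `S`. -/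
def memS (ν : Measure ℝ) (β : ℝ) (v : ℝ → ℝ) : Prop :=
  (∀ x, 0 ≤ v x) ∧ (∀ x, 0 ≤ x → x ≤ v x ∧ v x ≤ x + bbar ν β) ∧ (∀ x, x < 0 → v x = 0)
    ∧ MonotoneOn v (Ici 0) ∧ ContinuousOn v (Ici 0)

/-- A decision rule. -/
def DecisionRule (α : ℝ → ℝ) : Prop :=
  Measurable α ∧ (∀ x, 0 ≤ x → α x ∈ Icc 0 x) ∧ (∀ x, x < 0 → α x = 0)

/-- The operator `L_α` associated with a decision rule `α`. -/
def Ldiv (ν : Measure ℝ) (β γ : ℝ) (α : ℝ → ℝ) (v : ℝ → ℝ) (x : ℝ) : ℝ :=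
  if 0 ≤ x then
    α x - (β / γ) * Real.log
      ((∫ z in Ici (α x - x), Real.exp (-(γ * v (x - α x + z))) ∂ν)
        + (ν (Iio (α x - x))).toReal)
  else 0

/-- The function `Γ` associated with a value function `J`. -/
def Gam (ν : Measure ℝ) (β γ : ℝ) (J : ℝ → ℝ) (x : ℝ) : ℝ :=
  -(β / γ) * Real.log
    ((∫ z in Ici (-x), Real.exp (-(γ * J (x + z))) ∂ν) + (ν (Iio (-x))).toReal)

end
/-- The payoff functions on which `Ldiv` acts as a certainty equivalent: measurable, nonnegative,
and zero after ruin. -/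
structure IsPayoff (v : ℝ → ℝ) : Prop where
  measurable : Measurable v
  nonneg : ∀ x, 0 ≤ v x
  eq_zero : ∀ x, x < 0 → v x = 0

/-- The expected exponential disutility of `v` after one step from the reserve `y`. -/
noncomputable def disutility (ν : Measure ℝ) (γ : ℝ) (v : ℝ → ℝ) (y : ℝ) : ℝ :=
  ∫ z, Real.exp (-(γ * v (y + z))) ∂ν

theorem isPayoff_zero : IsPayoff (fun _ => 0) :=
  ⟨measurable_const, fun _ => le_rfl, fun _ _ => rfl⟩

theorem bbar_nonneg {ν : Measure ℝ} {β : ℝ} (hβ : β ∈ Ioo (0 : ℝ) 1) : 0 ≤ bbar ν β :=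
  div_nonneg (mul_nonneg hβ.1.le (integral_nonneg fun _ => le_max_right _ _))
    (sub_nonneg.2 hβ.2.le)

section

variable {ν : Measure ℝ} [IsProbabilityMeasure ν] {β γ : ℝ} {v w α : ℝ → ℝ}

theorem IsPayoff.exp_le_one (hv : IsPayoff v) (hγ : 0 < γ) (x : ℝ) :
    Real.exp (-(γ * v x)) ≤ 1 :=
  Real.exp_le_one_iff.2 (neg_nonpos.2 (mul_nonneg hγ.le (hv.nonneg x)))

theorem IsPayoff.integrable_exp (hv : IsPayoff v) (hγ : 0 < γ) (y : ℝ) :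
    Integrable (fun z => Real.exp (-(γ * v (y + z)))) ν := by
  have hm := hv.measurable
  refine Integrable.of_bound (C := 1) (Measurable.aestronglyMeasurable (by fun_prop))
    (ae_of_all _ fun z => ?_)
  rw [Real.norm_of_nonneg (Real.exp_pos _).le]
  exact hv.exp_le_one hγ _

theorem IsPayoff.disutility_pos (hv : IsPayoff v) (hγ : 0 < γ) (y : ℝ) :
    0 < disutility ν γ v y :=
  integral_exp_pos (hv.integrable_exp hγ y)

theorem IsPayoff.disutility_le_one (hv : IsPayoff v) (hγ : 0 < γ) (y : ℝ) :
    disutility ν γ v y ≤ 1 := by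
  have h := integral_mono (hv.integrable_exp (ν := ν) hγ y) (integrable_const 1)
    (fun z => hv.exp_le_one hγ (y + z))
  simpa [disutility] using h

theorem measurable_disutility (hm : Measurable v) : Measurable (disutility ν γ v) := by
  have h : StronglyMeasurable
      (Function.uncurry fun y z : ℝ => Real.exp (-(γ * v (y + z)))) := by
    apply Measurable.stronglyMeasurable
    unfold Function.uncurry
    fun_prop
  exact h.integral_prod_right.measurable

/-- Splitting the disutility into survival and ruin. -/
theorem IsPayoff.disutility_eq (hv : IsPayoff v) (hγ : 0 < γ) (y : ℝ) :
    (∫ z in Ici (-y), Real.exp (-(γ * v (y + z))) ∂ν) + (ν (Iio (-y))).toReal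
      = disutility ν γ v y := by
  rw [disutility, ← integral_add_compl (measurableSet_Ici (a := -y))
    (hv.integrable_exp (ν := ν) hγ y), compl_Ici]
  congr 1
  rw [setIntegral_congr_fun (s := Iio (-y)) (g := fun _ => (1 : ℝ)) measurableSet_Iio]
  · simp [Measure.real]
  · intro z hz
    have : y + z < 0 := by linarith [mem_Iio.1 hz]
    simp [hv.eq_zero _ this]

theorem IsPayoff.Gam_eq (hv : IsPayoff v) (hγ : 0 < γ) (y : ℝ) :
    Gam ν β γ v y = -(β / γ) * Real.log (disutility ν γ v y) := by
  rw [Gam, hv.disutility_eq hγ]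

theorem IsPayoff.Ldiv_of_nonneg (hv : IsPayoff v) (hγ : 0 < γ) {x : ℝ} (hx : 0 ≤ x) :
    Ldiv ν β γ α v x = α x - β / γ * Real.log (disutility ν γ v (x - α x)) := by
  rw [Ldiv, if_pos hx, ← neg_sub x (α x), hv.disutility_eq hγ]

theorem IsPayoff.map_Ldiv (hv : IsPayoff v) (hβ : 0 ≤ β) (hγ : 0 < γ) (hα : DecisionRule α) :
    IsPayoff (Ldiv ν β γ α v) := by
  refine ⟨?_, fun x => ?_, fun x hx => by simp [Ldiv, hx.not_ge]⟩
  · have h : Ldiv ν β γ α v = fun x => if 0 ≤ x then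
        α x - β / γ * Real.log (disutility ν γ v (x - α x)) else 0 := by
      funext x
      split_ifs with hx
      · exact hv.Ldiv_of_nonneg hγ hx
      · simp [Ldiv, hx]
    rw [h]
    have hm := measurable_disutility (ν := ν) (γ := γ) hv.measurable
    have hαm := hα.1
    exact Measurable.ite measurableSet_Ici (by fun_prop) measurable_const
  · rcases lt_or_ge x 0 with hx | hx
    · simp [Ldiv, hx.not_ge]
    · rw [hv.Ldiv_of_nonneg hγ hx]
      have h := Real.log_nonpos (hv.disutility_pos (ν := ν) hγ (x - α x)).le
        (hv.disutility_le_one hγ _)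
      have := mul_nonpos_of_nonneg_of_nonpos (div_nonneg hβ hγ.le) h
      linarith [(hα.2.1 x hx).1]

theorem IsPayoff.iterate_Ldiv (hv : IsPayoff v) (hβ : 0 ≤ β) (hγ : 0 < γ) (hα : DecisionRule α)
    (n : ℕ) : IsPayoff ((Ldiv ν β γ α)^[n] v) := by
  induction n with
  | zero => exact hv
  | succ n ih =>
    rw [Function.iterate_succ_apply']
    exact ih.map_Ldiv hβ hγ hα

/-- `Ldiv` is monotone and a `β`-contraction: it shrinks constant gaps by the factor `β`. -/
theorem IsPayoff.Ldiv_le_add (hv : IsPayoff v) (hw : IsPayoff w) (hβ : 0 ≤ β) (hγ : 0 < γ)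
    {C : ℝ} (hC : 0 ≤ C) (h : ∀ x, 0 ≤ x → v x ≤ w x + C) {x : ℝ} (hx : 0 ≤ x) :
    Ldiv ν β γ α v x ≤ Ldiv ν β γ α w x + β * C := by
  have hle : ∀ y, Real.exp (-(γ * C)) * disutility ν γ w y ≤ disutility ν γ v y := by
    intro y
    rw [disutility, disutility, ← integral_const_mul]
    refine integral_mono ((hw.integrable_exp hγ y).const_mul _) (hv.integrable_exp hγ y)
      fun z => ?_
    dsimp only
    rw [← Real.exp_add, Real.exp_le_exp]
    have : v (y + z) ≤ w (y + z) + C := by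
      rcases lt_or_ge (y + z) 0 with hz | hz
      · simpa [hv.eq_zero _ hz, hw.eq_zero _ hz] using hC
      · exact h _ hz
    nlinarith
  rw [hv.Ldiv_of_nonneg hγ hx, hw.Ldiv_of_nonneg hγ hx]
  have hpos := hw.disutility_pos (ν := ν) hγ (x - α x)
  have hlog := Real.log_le_log (mul_pos (Real.exp_pos _) hpos) (hle (x - α x))
  rw [Real.log_mul (Real.exp_pos _).ne' hpos.ne', Real.log_exp] at hlog
  have hmul := mul_le_mul_of_nonneg_left hlog (div_nonneg hβ hγ.le)
  have : β / γ * (γ * C) = β * C := by field_simp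
  linarith

theorem IsPayoff.iterate_Ldiv_le_add (hv : IsPayoff v) (hw : IsPayoff w) (hβ : 0 ≤ β)
    (hγ : 0 < γ) (hα : DecisionRule α) {C : ℝ} (hC : 0 ≤ C) (h : ∀ x, 0 ≤ x → v x ≤ w x + C)
    (n : ℕ) : ∀ x, 0 ≤ x → (Ldiv ν β γ α)^[n] v x
      ≤ (Ldiv ν β γ α)^[n] w x + β ^ n * C := by
  induction n with
  | zero => simpa using h
  | succ n ih =>
    intro x hx
    rw [Function.iterate_succ_apply', Function.iterate_succ_apply', pow_succ', mul_assoc]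
    exact (hv.iterate_Ldiv hβ hγ hα n).Ldiv_le_add (hw.iterate_Ldiv hβ hγ hα n) hβ hγ
      (by positivity) ih hx

/-- If a payoff lies below its image under `Ldiv`, then its iterates increase. -/
theorem IsPayoff.monotone_iterate_Ldiv (hv : IsPayoff v) (hβ : 0 ≤ β) (hγ : 0 < γ)
    (hα : DecisionRule α) (h : ∀ x, 0 ≤ x → v x ≤ Ldiv ν β γ α v x) {x : ℝ}
    (hx : 0 ≤ x) : Monotone fun n => (Ldiv ν β γ α)^[n] v x := by
  refine monotone_nat_of_le_succ fun n => ?_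
  have := hv.iterate_Ldiv_le_add (ν := ν) (hv.map_Ldiv hβ hγ hα) hβ hγ hα le_rfl (by simpa using h) n x hx
  simpa [Function.iterate_succ_apply] using this

/-- Jensen's inequality for the certainty equivalent of a payoff of at most linear growth. -/
theorem IsPayoff.Ldiv_le_linear (hv : IsPayoff v) (hβ : 0 ≤ β) (hγ : 0 < γ)
    (hα : DecisionRule α) (hint : Integrable (fun z => max z 0) ν) {b : ℝ} (hb : 0 ≤ b)
    (h : ∀ x, 0 ≤ x → v x ≤ x + b) {x : ℝ} (hx : 0 ≤ x) :
    Ldiv ν β γ α v x ≤ α x + β * (x - α x + (∫ z, max z 0 ∂ν) + b) := by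
  rw [hv.Ldiv_of_nonneg hγ hx]
  have hy : 0 ≤ x - α x := sub_nonneg.2 (hα.2.1 x hx).2
  set y := x - α x
  set m := ∫ z, max z 0 ∂ν
  have hle : Real.exp (-(γ * (y + m + b))) ≤ disutility ν γ v y := by
    have hdev : Integrable (fun z => γ * (m - max z 0)) ν :=
      ((integrable_const m).sub hint).const_mul γ
    have hi : Integrable (fun z => 1 + γ * (m - max z 0)) ν := (integrable_const 1).add hdev
    have hone : ∫ z, (1 + γ * (m - max z 0)) ∂ν = 1 := by
      rw [integral_add (integrable_const 1) hdev, integral_const_mul, integral_sub (integrable_const m) hint]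
      simp [m]
    calc Real.exp (-(γ * (y + m + b)))
        = ∫ z, Real.exp (-(γ * (y + m + b))) * (1 + γ * (m - max z 0)) ∂ν := by
          rw [integral_const_mul, hone, mul_one]
      _ ≤ disutility ν γ v y := by
          refine integral_mono (hi.const_mul _) (hv.integrable_exp hγ y) fun z => ?_
          have hz : v (y + z) ≤ y + max z 0 + b := by
            rcases lt_or_ge (y + z) 0 with hz | hz
            · rw [hv.eq_zero _ hz]
              have := le_max_right z 0
              linarith
            · linarith [h _ hz, le_max_left z 0]
          calc Real.exp (-(γ * (y + m + b))) * (1 + γ * (m - max z 0))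
              ≤ Real.exp (-(γ * (y + m + b))) * Real.exp (γ * (m - max z 0)) := by
                gcongr
                linarith [Real.add_one_le_exp (γ * (m - max z 0))]
            _ = Real.exp (-(γ * (y + max z 0 + b))) := by
                rw [← Real.exp_add]
                ring_nf
            _ ≤ Real.exp (-(γ * v (y + z))) := by gcongr
  have hlog := Real.log_le_log (Real.exp_pos _) hle
  rw [Real.log_exp] at hlog
  have hmul := mul_le_mul_of_nonneg_left hlog (div_nonneg hβ hγ.le)
  have : β / γ * (γ * (y + m + b)) = β * (y + m + b) := by field_simp
  linarith

theorem IsPayoff.Ldiv_le_bbar (hv : IsPayoff v) (hβ : β ∈ Ioo (0 : ℝ) 1) (hγ : 0 < γ)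
    (hα : DecisionRule α) (hint : Integrable (fun z => max z 0) ν)
    (h : ∀ x, 0 ≤ x → v x ≤ x + bbar ν β) {x : ℝ} (hx : 0 ≤ x) :
    Ldiv ν β γ α v x ≤ x + bbar ν β := by
  have hL := hv.Ldiv_le_linear hβ.1.le hγ hα hint (bbar_nonneg hβ) h hx
  have hb : (1 - β) * bbar ν β = β * ∫ z, max z 0 ∂ν :=
    mul_div_cancel₀ _ (sub_pos.2 hβ.2).ne'
  nlinarith [(hα.2.1 x hx).2, hβ.2]

theorem IsPayoff.iterate_Ldiv_le_bbar (hv : IsPayoff v) (hβ : β ∈ Ioo (0 : ℝ) 1) (hγ : 0 < γ)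
    (hα : DecisionRule α) (hint : Integrable (fun z => max z 0) ν)
    (h : ∀ x, 0 ≤ x → v x ≤ x + bbar ν β) (n : ℕ) :
    ∀ x, 0 ≤ x → (Ldiv ν β γ α)^[n] v x ≤ x + bbar ν β := by
  induction n with
  | zero => exact h
  | succ n ih =>
    intro x hx
    rw [Function.iterate_succ_apply']
    exact (hv.iterate_Ldiv hβ.1.le hγ hα n).Ldiv_le_bbar hβ hγ hα hint ih hx

theorem isPayoff_of_tendsto {f : ℕ → ℝ → ℝ} (hf : ∀ n, IsPayoff (f n))
    (hlim : ∀ x, Tendsto (fun n => f n x) atTop (𝓝 (v x))) : IsPayoff v where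
  measurable := measurable_of_tendsto_metrizable (fun n => (hf n).measurable)
    (tendsto_pi_nhds.2 hlim)
  nonneg x := ge_of_tendsto' (hlim x) fun n => (hf n).nonneg x
  eq_zero x hx := tendsto_nhds_unique (hlim x) (by simp [fun n => (hf n).eq_zero x hx])

/-- `Ldiv` is continuous along pointwise limits of payoffs. -/
theorem tendsto_Ldiv {f : ℕ → ℝ → ℝ} (hf : ∀ n, IsPayoff (f n)) (hγ : 0 < γ)
    (hlim : ∀ x, Tendsto (fun n => f n x) atTop (𝓝 (v x))) {x : ℝ} (hx : 0 ≤ x) :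
    Tendsto (fun n => Ldiv ν β γ α (f n) x) atTop (𝓝 (Ldiv ν β γ α v x)) := by
  have hv := isPayoff_of_tendsto hf hlim
  have hdis : Tendsto (fun n => disutility ν γ (f n) (x - α x)) atTop
      (𝓝 (disutility ν γ v (x - α x))) := by
    refine tendsto_integral_of_dominated_convergence (fun _ => 1)
      (fun n => ((hf n).integrable_exp hγ _).aestronglyMeasurable) (integrable_const _)
      (fun n => ae_of_all _ fun z => ?_) (ae_of_all _ fun z => ?_)
    · rw [Real.norm_of_nonneg (Real.exp_pos _).le]
      exact (hf n).exp_le_one hγ _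
    · exact (Real.continuous_exp.tendsto _).comp ((hlim _).const_mul γ).neg
  rw [hv.Ldiv_of_nonneg hγ hx]
  simp_rw [fun n => (hf n).Ldiv_of_nonneg (ν := ν) (β := β) (α := α) hγ hx]
  exact ((hdis.log (hv.disutility_pos hγ _).ne').const_mul _).const_sub _

/-- The value of a decision rule is a fixed point of its operator. -/
theorem Ldiv_eq_of_tendsto_iterate (hβ : 0 ≤ β) (hγ : 0 < γ) (hα : DecisionRule α)
    (hlim : ∀ x, Tendsto (fun n => (Ldiv ν β γ α)^[n] (fun _ => 0) x) atTop (𝓝 (v x)))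
    {x : ℝ} (hx : 0 ≤ x) : Ldiv ν β γ α v x = v x := by
  have h := tendsto_Ldiv (ν := ν) (β := β) (α := α)
    (isPayoff_zero.iterate_Ldiv hβ hγ hα) hγ hlim hx
  refine tendsto_nhds_unique h (((tendsto_add_atTop_iff_nat 1).2 (hlim x)).congr fun n => ?_)
  rw [Function.iterate_succ_apply']

/-- The iterates from zero converge, with limit at most `x + b̄`. -/
theorem exists_tendsto_iterate_Ldiv (hβ : β ∈ Ioo (0 : ℝ) 1) (hγ : 0 < γ)
    (hα : DecisionRule α) (hint : Integrable (fun z => max z 0) ν) :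
    ∃ J : ℝ → ℝ,
      (∀ x, Tendsto (fun n => (Ldiv ν β γ α)^[n] (fun _ => 0) x) atTop (𝓝 (J x))) ∧
      ∀ x, 0 ≤ x → J x ≤ x + bbar ν β := by
  have hbound := isPayoff_zero.iterate_Ldiv_le_bbar hβ hγ hα hint
    fun x hx => add_nonneg hx (bbar_nonneg hβ)
  have hconv : ∀ x, ∃ l,
      Tendsto (fun n => (Ldiv ν β γ α)^[n] (fun _ => 0) x) atTop (𝓝 l) := by
    intro x
    rcases lt_or_ge x 0 with hx | hx
    · refine ⟨0, ?_⟩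
      simp [fun n => (isPayoff_zero.iterate_Ldiv (ν := ν) hβ.1.le hγ hα n).eq_zero x hx]
    · exact ⟨_, tendsto_atTop_ciSup (isPayoff_zero.monotone_iterate_Ldiv hβ.1.le hγ hα
        (fun y _ => (isPayoff_zero.map_Ldiv hβ.1.le hγ hα).nonneg y) hx)
        ⟨x + bbar ν β, forall_mem_range.2 fun n => hbound n x hx⟩⟩
  choose J hJ using hconv
  exact ⟨J, hJ, fun x hx => le_of_tendsto' (hJ x) fun n => hbound n x hx⟩

/-- If the reserve left by `α` is bounded, a payoff of linear growth below its image under `Ldiv`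
is below the value of `α`. -/
theorem IsPayoff.le_of_le_Ldiv (hv : IsPayoff v) (hβ : β ∈ Ioo (0 : ℝ) 1) (hγ : 0 < γ)
    (hα : DecisionRule α) (hint : Integrable (fun z => max z 0) ν) {b ξ : ℝ} (hb : 0 ≤ b)
    (hξ : 0 ≤ ξ) (hle : ∀ x, 0 ≤ x → v x ≤ x + b) (hαξ : ∀ x, 0 ≤ x → x - α x ≤ ξ)
    (h : ∀ x, 0 ≤ x → v x ≤ Ldiv ν β γ α v x)
    (hw : ∀ x, Tendsto (fun n => (Ldiv ν β γ α)^[n] (fun _ => 0) x) atTop (𝓝 (w x)))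
    {x : ℝ} (hx : 0 ≤ x) : v x ≤ w x := by
  have hm : 0 ≤ ∫ z, max z 0 ∂ν := integral_nonneg fun _ => le_max_right _ _
  set C := β * (ξ + (∫ z, max z 0 ∂ν) + b)
  have hC : 0 ≤ C := mul_nonneg hβ.1.le (by positivity)
  have hone : ∀ y, 0 ≤ y → Ldiv ν β γ α v y
      ≤ Ldiv ν β γ α (fun _ => 0) y + C := by
    intro y hy
    have h0 : Ldiv ν β γ α (fun _ => 0) y = α y := by
      rw [isPayoff_zero.Ldiv_of_nonneg hγ hy]
      simp [disutility]
    rw [h0]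
    refine (hv.Ldiv_le_linear hβ.1.le hγ hα hint hb hle hy).trans ?_
    have := mul_le_mul_of_nonneg_left (hαξ y hy) hβ.1.le
    simp only [C]
    linarith
  have hgap : ∀ n, v x
      ≤ (Ldiv ν β γ α)^[n + 1] (fun _ => 0) x + β ^ n * C := fun n =>
    (hv.monotone_iterate_Ldiv hβ.1.le hγ hα h hx (Nat.zero_le (n + 1))).trans
      ((hv.map_Ldiv hβ.1.le hγ hα).iterate_Ldiv_le_add (isPayoff_zero.map_Ldiv hβ.1.le hγ hα)
        hβ.1.le hγ hα hC hone n x hx)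
  have hlim := ((tendsto_add_atTop_iff_nat 1).2 (hw x)).add
    ((tendsto_pow_atTop_nhds_zero_of_lt_one hβ.1.le hβ.2).mul_const C)
  rw [zero_mul, add_zero] at hlim
  exact ge_of_tendsto' hlim hgap

end

/-- the policy improvement step improves the value:
`x ≤ J_α(x) ≤ J_δ(x) ≤ x + b̄` for all `x ≥ 0`. -/
theorem policy_improvement_improves (ν : Measure ℝ) [IsProbabilityMeasure ν]
    (hac : ν ≪ volume) (hint : Integrable (fun z => max z 0) ν)
    (hneg : 0 < ν (Iio 0)) (β γ : ℝ) (hβ : β ∈ Ioo (0:ℝ) 1) (hγ : 0 < γ)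
    (α : ℝ → ℝ) (hα : DecisionRule α) (Jα : ℝ → ℝ)
    (hJα : ∀ x : ℝ, Tendsto (fun n => (Ldiv ν β γ α)^[n] (fun _ => 0) x)
      atTop (𝓝 (Jα x)))
    (hJαb : ∀ x : ℝ, 0 ≤ x → x ≤ Jα x ∧ Jα x ≤ x + bbar ν β)
    (δ : ℝ → ℝ) (hδrule : DecisionRule δ)
    (hδ : ∀ x : ℝ, 0 ≤ x →
      IsGreatest {a | a ∈ Icc 0 x ∧
        ∀ a' ∈ Icc 0 x, a' + Gam ν β γ Jα (x - a') ≤ a + Gam ν β γ Jα (x - a)}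
        (δ x))
    (hδξ : ∀ x : ℝ, bbar ν β / (1 - β) < x → x - bbar ν β / (1 - β) ≤ δ x) :
    ∃ Jδ : ℝ → ℝ,
      (∀ x : ℝ, Tendsto (fun n => (Ldiv ν β γ δ)^[n] (fun _ => 0) x)
        atTop (𝓝 (Jδ x))) ∧
      ∀ x : ℝ, 0 ≤ x → x ≤ Jα x ∧ Jα x ≤ Jδ x ∧ Jδ x ≤ x + bbar ν β := by
  have hJ := isPayoff_of_tendsto (isPayoff_zero.iterate_Ldiv hβ.1.le hγ hα) hJα
  have hb := bbar_nonneg (ν := ν) hβ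
  have hξ : 0 ≤ bbar ν β / (1 - β) := div_nonneg hb (sub_nonneg.2 hβ.2.le)
  obtain ⟨Jδ, hJδ, hJδb⟩ := exists_tendsto_iterate_Ldiv hβ hγ hδrule hint
  refine ⟨Jδ, hJδ, fun x hx => ⟨(hJαb x hx).1, ?_, hJδb x hx⟩⟩
  refine hJ.le_of_le_Ldiv hβ hγ hδrule hint hb hξ (fun y hy => (hJαb y hy).2)
    (fun y hy => ?_) (fun y hy => ?_) hJδ hx
  · rcases le_or_gt y (bbar ν β / (1 - β)) with hle | hlt
    · linarith [(hδrule.2.1 y hy).1]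
    · linarith [hδξ y hlt]
  · have hmax := (hδ y hy).1.2 (α y) (hα.2.1 y hy)
    have hfix := Ldiv_eq_of_tendsto_iterate hβ.1.le hγ hα hJα hy
    rw [hJ.Ldiv_of_nonneg hγ hy] at hfix
    rw [hJ.Ldiv_of_nonneg hγ hy]
    rw [hJ.Gam_eq hγ, hJ.Gam_eq hγ] at hmax
    linarith
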